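/- Suppose ε₁ε₂ε₃ = −1, let S₁, S₂, S₃ be skew-symmetric ℝ-linear endomorphisms of E, and define T₂ := ε₁·S₁ ∘ S₃ and T₃ := ε₂·S₂ ∘ S₁. Then (S₁, S₂, S₃) is an ε-hypersymplectic structure on (E, B, b) if and only if (S₁, T₂, T₃) is an ε-hypersymplectic structure on (E, B, b) (with the same ε). Moreover, in this case T₃ ∘ T₂ ∘ S₁ = ε₁ε₃·(S₃ ∘ S₂ ∘ S₁), i.e. the two structures determine equal or opposite pseudo-metrics. -/

import Mathlib

variable {E : Type*} [AddCommGroup E] [Module ℝ E]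

/-- The deformed bracket `b_I(X,Y) = b(I X, Y) + b(X, I Y) - I (b(X,Y))`. -/
noncomputable def deform (b : E →ₗ[ℝ] E →ₗ[ℝ] E) (I : E →ₗ[ℝ] E) :
    E →ₗ[ℝ] E →ₗ[ℝ] E :=
  b ∘ₗ I + LinearMap.compl₂ b I - LinearMap.compr₂ b I

/-- The Nijenhuis torsion of `I` with respect to `b`:
`T_b I (X,Y) = b(I X, I Y) - I (b_I(X,Y))`. -/
noncomputable def torsion (b : E →ₗ[ℝ] E →ₗ[ℝ] E) (I : E →ₗ[ℝ] E) (X Y : E) : E :=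
  b (I X) (I Y) - I (deform b I X Y)

/-- The concomitant `C_b(I,J)(X,Y) = b_{I,J}(X,Y) + b_{J,I}(X,Y)`. -/
noncomputable def concomitant (b : E →ₗ[ℝ] E →ₗ[ℝ] E) (I J : E →ₗ[ℝ] E) (X Y : E) : E :=
  deform (deform b I) J X Y + deform (deform b J) I X Y

/-- An ε-hypersymplectic structure on `(E, B, b)`: a triple `S i` (indices in `ZMod 3`,
with `3 ≡ 0`) of `B`-skew-symmetric endomorphisms such that `S i ∘ S i = ε i • id`,
`S i ∘ S j = ε₁ε₂ε₃ • (S j ∘ S i)` for `i ≠ j`, and `b_{S i, S i} = ε i • b`. -/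
noncomputable def IsEpsHypersymplectic (B : E →ₗ[ℝ] E →ₗ[ℝ] ℝ) (b : E →ₗ[ℝ] E →ₗ[ℝ] E)
    (ε : ZMod 3 → ℝ) (S : ZMod 3 → E →ₗ[ℝ] E) : Prop :=
  (∀ i, ∀ X Y : E, B (S i X) Y = - B X (S i Y)) ∧
  (∀ i, S i ∘ₗ S i = ε i • (LinearMap.id : E →ₗ[ℝ] E)) ∧
  (∀ i j, i ≠ j → S i ∘ₗ S j = (ε 0 * ε 1 * ε 2) • (S j ∘ₗ S i)) ∧
  (∀ i, deform (deform b (S i)) (S i) = ε i • b)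

/-- The transition endomorphisms `T i := ε (i-1) • (S (i-1) ∘ S (i+1))`. -/
noncomputable def transMor (ε : ZMod 3 → ℝ) (S : ZMod 3 → E →ₗ[ℝ] E) (i : ZMod 3) :
    E →ₗ[ℝ] E :=
  ε (i - 1) • (S (i - 1) ∘ₗ S (i + 1))

/-- The endomorphism `G := S₃ ∘ S₂ ∘ S₁` (with `S₃ = S 0`). -/
noncomputable def metricG (S : ZMod 3 → E →ₗ[ℝ] E) : E →ₗ[ℝ] E :=
  S 0 ∘ₗ S 2 ∘ₗ S 1


theorem deform_apply (b : E →ₗ[ℝ] E →ₗ[ℝ] E) (I : E →ₗ[ℝ] E) (X Y : E) :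
    deform b I X Y = b (I X) Y + b X (I Y) - I (b X Y) := by
  simp [deform]

theorem torsion_smul (b : E →ₗ[ℝ] E →ₗ[ℝ] E) (c : ℝ) (I : E →ₗ[ℝ] E) (X Y : E) :
    torsion b (c • I) X Y = (c * c) • torsion b I X Y := by
  simp only [torsion, deform_apply, LinearMap.smul_apply, map_smul, map_add, map_sub]
  module

theorem deform_deform_apply (b : E →ₗ[ℝ] E →ₗ[ℝ] E) {I : E →ₗ[ℝ] E} {α : ℝ}
    (hI : ∀ X, I (I X) = α • X) (X Y : E) :
    deform (deform b I) I X Y = α • b X Y + (2 : ℝ) • torsion b I X Y := by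
  simp only [torsion, deform_apply, map_smul, map_add, map_sub, hI, LinearMap.smul_apply]
  module

theorem deform_deform_eq_smul_iff (b : E →ₗ[ℝ] E →ₗ[ℝ] E) {I : E →ₗ[ℝ] E} {α : ℝ}
    (hI : ∀ X, I (I X) = α • X) :
    deform (deform b I) I = α • b ↔ ∀ X Y, torsion b I X Y = 0 := by
  simp [LinearMap.ext_iff, deform_deform_apply b hI]

/-- The torsion of the composite of two anticommuting endomorphisms with scalar squares, in terms
of their torsions. -/
theorem two_smul_torsion_comp (b : E →ₗ[ℝ] E →ₗ[ℝ] E) {I J : E →ₗ[ℝ] E} {α β : ℝ}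
    (hI : ∀ X, I (I X) = α • X) (hJ : ∀ X, J (J X) = β • X)
    (hJI : ∀ X, J (I X) = -I (J X)) (X Y : E) :
    (2 : ℝ) • torsion b (I ∘ₗ J) X Y =
      torsion b I (J X) (J Y) - J (torsion b I (J X) Y) - J (torsion b I X (J Y))
        - β • torsion b I X Y
        + (torsion b J (I X) (I Y) - I (torsion b J (I X) Y) - I (torsion b J X (I Y))
        - α • torsion b J X Y) := by
  simp only [torsion, deform_apply, LinearMap.comp_apply, map_smul, map_add, map_sub, map_neg,
    hI, hJ, hJI, LinearMap.neg_apply]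
  module

theorem torsion_comp_eq_zero (b : E →ₗ[ℝ] E →ₗ[ℝ] E) {I J : E →ₗ[ℝ] E} {α β : ℝ}
    (hI : ∀ X, I (I X) = α • X) (hJ : ∀ X, J (J X) = β • X)
    (hJI : ∀ X, J (I X) = -I (J X)) (hbI : ∀ X Y, torsion b I X Y = 0)
    (hbJ : ∀ X Y, torsion b J X Y = 0) (X Y : E) : torsion b (I ∘ₗ J) X Y = 0 := by
  have h := two_smul_torsion_comp b hI hJ hJI X Y
  simpa [hbI, hbJ] using h

theorem ZMod.forall_three {P : ZMod 3 → Prop} : (∀ i, P i) ↔ P 0 ∧ P 1 ∧ P 2 := by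
  refine ⟨fun h => ⟨h 0, h 1, h 2⟩, fun ⟨h0, h1, h2⟩ i => ?_⟩
  fin_cases i
  exacts [h0, h1, h2]

/-- For `ε₁ε₂ε₃ = -1`, an ε-hypersymplectic structure is a triple of skew-symmetric, pairwise
anticommuting Nijenhuis endomorphisms with squares `ε i`. -/
theorem isEpsHypersymplectic_iff {B : E →ₗ[ℝ] E →ₗ[ℝ] ℝ} {b : E →ₗ[ℝ] E →ₗ[ℝ] E}
    {ε : ZMod 3 → ℝ} {S : ZMod 3 → E →ₗ[ℝ] E} (he : ε 0 * ε 1 * ε 2 = -1) :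
    IsEpsHypersymplectic B b ε S ↔
      (∀ i, ∀ X Y, B (S i X) Y = -B X (S i Y)) ∧
      (∀ i X, S i (S i X) = ε i • X) ∧
      (∀ i j, i ≠ j → ∀ X, S i (S j X) = -S j (S i X)) ∧
      (∀ i X Y, torsion b (S i) X Y = 0) := by
  have hsq : (∀ i, S i ∘ₗ S i = ε i • (LinearMap.id : E →ₗ[ℝ] E)) ↔
      ∀ i X, S i (S i X) = ε i • X := by simp [LinearMap.ext_iff]
  have hanti : (∀ i j, i ≠ j → S i ∘ₗ S j = (ε 0 * ε 1 * ε 2) • (S j ∘ₗ S i)) ↔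
      ∀ i j, i ≠ j → ∀ X, S i (S j X) = -S j (S i X) := by simp [LinearMap.ext_iff, he]
  rw [IsEpsHypersymplectic, hsq, hanti]
  refine and_congr_right fun _ => and_congr_right fun h => and_congr_right fun _ => ?_
  exact forall_congr' fun i => deform_deform_eq_smul_iff b (h i)

theorem IsEpsHypersymplectic.smul {B : E →ₗ[ℝ] E →ₗ[ℝ] ℝ} {b : E →ₗ[ℝ] E →ₗ[ℝ] E}
    {ε : ZMod 3 → ℝ} {S : ZMod 3 → E →ₗ[ℝ] E} (he : ε 0 * ε 1 * ε 2 = -1)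
    (h : IsEpsHypersymplectic B b ε S) {c : ZMod 3 → ℝ} (hc : ∀ i, c i * c i = 1) :
    IsEpsHypersymplectic B b ε (fun i => c i • S i) := by
  rw [isEpsHypersymplectic_iff he] at h ⊢
  obtain ⟨hskew, hsq, hanti, htor⟩ := h
  refine ⟨fun i X Y => ?_, fun i X => ?_, fun i j hij X => ?_, fun i X Y => ?_⟩
  · simp [hskew]
  · simp [hsq, smul_smul, ← mul_assoc, hc]
  · simp [hanti i j hij, smul_smul, mul_comm]
  · simp [torsion_smul, htor]

/-- The triple `(S₁, T₂, T₃)` obtained by replacing `S₂`, `S₃` by transition endomorphisms. -/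
noncomputable def transitionTriple (ε : ZMod 3 → ℝ) (S : ZMod 3 → E →ₗ[ℝ] E) :
    ZMod 3 → E →ₗ[ℝ] E :=
  fun i => if i = 1 then S 1
    else if i = 2 then ε 1 • (S 1 ∘ₗ S 0)
    else ε 2 • (S 2 ∘ₗ S 1)

theorem transitionTriple_zero (ε : ZMod 3 → ℝ) (S : ZMod 3 → E →ₗ[ℝ] E) :
    transitionTriple ε S 0 = ε 2 • (S 2 ∘ₗ S 1) := rfl

theorem transitionTriple_one (ε : ZMod 3 → ℝ) (S : ZMod 3 → E →ₗ[ℝ] E) :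
    transitionTriple ε S 1 = S 1 := rfl

theorem transitionTriple_two (ε : ZMod 3 → ℝ) (S : ZMod 3 → E →ₗ[ℝ] E) :
    transitionTriple ε S 2 = ε 1 • (S 1 ∘ₗ S 0) := rfl

theorem IsEpsHypersymplectic.transition {B : E →ₗ[ℝ] E →ₗ[ℝ] ℝ}
    {b : E →ₗ[ℝ] E →ₗ[ℝ] E} {ε : ZMod 3 → ℝ} {S : ZMod 3 → E →ₗ[ℝ] E}
    (hε : ∀ i, ε i * ε i = 1) (he : ε 0 * ε 1 * ε 2 = -1)
    (h : IsEpsHypersymplectic B b ε S) :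
    IsEpsHypersymplectic B b ε (transitionTriple ε S) := by
  rw [isEpsHypersymplectic_iff he] at h ⊢
  obtain ⟨hskew, hsq, hanti, htor⟩ := h
  have h01 := hanti 0 1 (by decide)
  have h12 := hanti 1 2 (by decide)
  have h02 := hanti 0 2 (by decide)
  have e0 : ε 1 * ε 2 = -ε 0 := by linear_combination ε 0 * he - ε 1 * ε 2 * hε 0
  have e2 : ε 0 * ε 1 = -ε 2 := by linear_combination ε 2 * he - ε 0 * ε 1 * hε 2
  have h10_comp := torsion_comp_eq_zero b (hsq 1) (hsq 0) h01 (htor 1) (htor 0)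
  have h21_comp := torsion_comp_eq_zero b (hsq 2) (hsq 1) h12 (htor 2) (htor 1)
  have t01 : ∀ X, transitionTriple ε S 0 (transitionTriple ε S 1 X) =
      -transitionTriple ε S 1 (transitionTriple ε S 0 X) := by
    simp [transitionTriple_zero, transitionTriple_one, h12]
  have t12 : ∀ X, transitionTriple ε S 1 (transitionTriple ε S 2 X) =
      -transitionTriple ε S 2 (transitionTriple ε S 1 X) := by
    simp [transitionTriple_one, transitionTriple_two, h01]
  have t02 : ∀ X, transitionTriple ε S 0 (transitionTriple ε S 2 X) =
      -transitionTriple ε S 2 (transitionTriple ε S 0 X) := by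
    intro X
    simp only [transitionTriple_zero, transitionTriple_two, LinearMap.smul_apply,
      LinearMap.comp_apply, map_smul, map_neg, hsq, h01, h02, h12]
    module
  refine ⟨ZMod.forall_three.2 ⟨fun X Y => ?_, hskew 1, fun X Y => ?_⟩,
    ZMod.forall_three.2 ⟨fun X => ?_, hsq 1, fun X => ?_⟩, ?_,
    ZMod.forall_three.2 ⟨fun X Y => ?_, htor 1, fun X Y => ?_⟩⟩
  · simp [transitionTriple_zero, hskew, h12]
  · simp [transitionTriple_two, hskew, h01]
  · simp only [transitionTriple_zero, LinearMap.smul_apply, LinearMap.comp_apply, map_smul,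
      hsq, h12, smul_smul, ← neg_smul]
    congr 1
    linear_combination (-ε 1 * ε 2) * hε 2 - e0
  · simp only [transitionTriple_two, LinearMap.smul_apply, LinearMap.comp_apply, map_smul,
      hsq, h01, smul_smul, ← neg_smul]
    congr 1
    linear_combination (-ε 0 * ε 1) * hε 1 - e2
  · simp [ZMod.forall_three, t01, t12, t02]
  · simp [transitionTriple_zero, torsion_smul, h21_comp]
  · simp [transitionTriple_two, torsion_smul, h10_comp]

theorem statement16 (B : E →ₗ[ℝ] E →ₗ[ℝ] ℝ) (b : E →ₗ[ℝ] E →ₗ[ℝ] E)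
    (ε : ZMod 3 → ℝ) (S : ZMod 3 → E →ₗ[ℝ] E)
    (hε : ∀ i, ε i = 1 ∨ ε i = -1)
    (hBsymm : ∀ X Y : E, B X Y = B Y X)
    (hBnd : ∀ X : E, (∀ Y : E, B X Y = 0) → X = 0)
    (he : ε 0 * ε 1 * ε 2 = -1)
    (hskew : ∀ k, ∀ X Y : E, B (S k X) Y = - B X (S k Y)) :
    (IsEpsHypersymplectic B b ε S ↔
      IsEpsHypersymplectic B b ε
        (fun i => if i = 1 then S 1
          else if i = 2 then ε 1 • (S 1 ∘ₗ S 0)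
          else ε 2 • (S 2 ∘ₗ S 1))) ∧
    (IsEpsHypersymplectic B b ε S →
      (ε 2 • (S 2 ∘ₗ S 1)) ∘ₗ (ε 1 • (S 1 ∘ₗ S 0)) ∘ₗ S 1 =
        (ε 1 * ε 0) • (S 0 ∘ₗ S 2 ∘ₗ S 1)) := by
  have hε' : ∀ i, ε i * ε i = 1 := fun i => by rcases hε i with h | h <;> simp [h]
  have e2 : ε 1 * ε 0 = -ε 2 := by linear_combination ε 2 * he - ε 0 * ε 1 * hε' 2
  refine ⟨⟨fun h => h.transition hε' he, fun h => ?_⟩, fun h => ?_⟩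
  · change IsEpsHypersymplectic B b ε (transitionTriple ε S) at h
    have hT := h.transition hε' he
    rw [isEpsHypersymplectic_iff he] at h
    obtain ⟨-, hsq, hanti, -⟩ := h
    have hS : S = fun i => (if i = 1 then 1 else -ε 2 : ℝ) •
        transitionTriple ε (transitionTriple ε S) i := by
      have h10 : ∀ X, S 1 (ε 2 • S 2 (S 1 X)) = -(ε 2 • S 2 (S 1 (S 1 X))) :=
        hanti 1 0 (by decide)
      have h1 : ∀ X, S 1 (S 1 X) = ε 1 • X := hsq 1
      have h12 : ∀ X, S 1 (ε 1 • S 1 (S 0 X)) = -(ε 1 • S 1 (S 0 (S 1 X))) :=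
        hanti 1 2 (by decide)
      refine funext (ZMod.forall_three.2 ⟨?_, ?_, ?_⟩) <;> ext X
      · change S 0 X = -ε 2 • ε 2 • ε 1 • S 1 (S 0 (S 1 X))
        rw [← neg_eq_iff_eq_neg.mpr (h12 X)]
        simp [h1, smul_smul, hε']
      · exact (one_smul ℝ _).symm
      · change S 2 X = -ε 2 • ε 1 • S 1 (ε 2 • S 2 (S 1 X))
        have hc : ε 2 * (ε 1 * (ε 2 * ε 1)) = 1 := by
          linear_combination ε 1 * ε 1 * hε' 2 + hε' 1
        rw [h10]
        simp [h1, smul_smul, hc]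
    rw [hS]
    refine hT.smul he fun i => ?_
    split_ifs <;> simp [hε']
  · rw [isEpsHypersymplectic_iff he] at h
    obtain ⟨-, hsq, hanti, -⟩ := h
    ext X
    simp [hsq, hanti 2 0 (by decide), e2, smul_smul, hε']
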